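/- (Soundness of p-separation.) Let G = (V,E) be a directed graph with finite vertex set and let V_1, V_2, V_3 be disjoint subsets of V with V_1, V_2 nonempty. If (V_1 ⊥^p V_2 | V_3)_G holds, then for every consistent finite functional causal model M on G, the random variables satisfy the conditional independence (X_1 ⫫ X_2 | X_3) with respect to the distribution P(x)_G of M, where X_i = {X_v}_{v∈V_i}. -/

import Mathlib

open Finset

noncomputable section

/-- A directed graph (vertex type `V`, edge relation `E`) is acyclic if it contains no
directed cycle. -/
def Acyclic {V : Type*} (E : V → V → Prop) : Prop :=
  ∀ v, ¬ Relation.TransGen E v v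

/-- An undirected path in a directed graph `E`: a duplicate-free list of vertices in which
consecutive vertices are joined by an edge in one direction or the other. -/
def IsUPath {V : Type*} (E : V → V → Prop) (p : List V) : Prop :=
  p.Chain' (fun x y => E x y ∨ E y x) ∧ p.Nodup

/-- A path `p` (given as a list of vertices) is blocked by a set `V₃` if it contains three
consecutive vertices `A, W, B` forming either a chain `A → W → B` (in either direction along
the path) with `W ∈ V₃`, a fork `A ← W → B` with `W ∈ V₃`, or a collider `A → W ← B` such
that neither `W` nor any descendant of `W` belongs to `V₃`. -/
def BlockedPath {V : Type*} (E : V → V → Prop) (V3 : Set V) (p : List V) : Prop :=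
  ∃ (l : List V) (A W B : V) (r : List V), p = l ++ A :: W :: B :: r ∧
    ((E A W ∧ E W B ∧ W ∈ V3) ∨
     (E B W ∧ E W A ∧ W ∈ V3) ∨
     (E W A ∧ E W B ∧ W ∈ V3) ∨
     (E A W ∧ E B W ∧ W ∉ V3 ∧ ∀ d, Relation.TransGen E W d → d ∉ V3))

/-- `d`-separation: `V₁` and `V₂` are `d`-separated given `V₃` if every (undirected) path
from a vertex of `V₁` to a vertex of `V₂` is blocked by `V₃` (in particular, if there is no
such path). -/
def DSep {V : Type*} (E : V → V → Prop) (V1 V2 V3 : Set V) : Prop :=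
  ∀ (p : List V) (A B : V), A ∈ V1 → B ∈ V2 → IsUPath E p →
    p.head? = some A → p.getLast? = some B → BlockedPath E V3 p

/-- The edge relation of the classical teleportation graph `G^s` built from a directed graph
`G = (V, E)` and a set `S ⊆ V` of split vertices.  Its vertices are `V ⊕ (S ⊕ S)`:
`Sum.inl v` is an original vertex, `Sum.inr (Sum.inl ⟨v,_⟩)` is the pre-selection vertex
`R_v`, and `Sum.inr (Sum.inr ⟨v,_⟩)` is the post-selection vertex `T_v`.  Its edges are the
original edges of `G` whose source is not split, the rerouted edges `(R_v, w)` for every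
child `w` of `v ∈ S` in `G`, and the new edges `(v, T_v)` and `(R_v, T_v)` for `v ∈ S`. -/
def teleE {V : Type*} (E : V → V → Prop) (S : Set V) :
    V ⊕ (↥S ⊕ ↥S) → V ⊕ (↥S ⊕ ↥S) → Prop
  | Sum.inl a, Sum.inl b => E a b ∧ a ∉ S
  | Sum.inr (Sum.inl rv), Sum.inl b => E rv.1 b
  | Sum.inl a, Sum.inr (Sum.inr tv) => a = tv.1
  | Sum.inr (Sum.inl rv), Sum.inr (Sum.inr tv) => rv.1 = tv.1
  | _, _ => False

/-- The set of post-selection vertices `𝒯 = {T_v}_{v∈S}` of the teleportation graph. -/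
def postVerts {V : Type*} (S : Set V) : Set (V ⊕ (↥S ⊕ ↥S)) :=
  Set.range fun tv : ↥S => Sum.inr (Sum.inr tv)

/-- `p`-separation: `(V₁ ⊥^p V₂ | V₃)_G` holds iff there exists a valid split set
`S ⊆ V` (i.e. one such that removing all outgoing edges of vertices in `S` yields an acyclic
graph) such that, in the associated classical teleportation graph `G^s`,
`(V₁ ⊥^d V₂ | V₃ ∪ 𝒯)_{G^s}` where `𝒯` is the set of post-selection vertices. -/
def PSep {V : Type*} (E : V → V → Prop) (V1 V2 V3 : Set V) : Prop :=
  ∃ S : Set V, (Acyclic fun a b => E a b ∧ a ∉ S) ∧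
    DSep (teleE E S) (Sum.inl '' V1) (Sum.inl '' V2)
      (Sum.inl '' V3 ∪ postVerts S)

/-- The Kronecker delta `δ_{x,y}` as a real number: `1` if `x = y` and `0` otherwise. -/
def kron {α : Type*} (x y : α) : ℝ := by
  classical exact if x = y then 1 else 0

/-- A finite functional causal model (fCM) on a directed graph `G = (V, E)` with finite
vertex set: each vertex `v` carries a nonempty finite set `X v` of values, a finite set
`U v` of error values with a probability distribution `pU v`, and a function
`f v : X_{pa(v)} × U_v → X_v` (the dependence on the parents `pa(v) = {w : E w v}` is
encoded by giving `f v` access to the values of all `w` with `E w v`). -/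
structure FCM (V : Type) [Fintype V] [DecidableEq V] (E : V → V → Prop) where
  X : V → Type
  fintX : ∀ v, Fintype (X v)
  neX : ∀ v, Nonempty (X v)
  U : V → Type
  fintU : ∀ v, Fintype (U v)
  pU : ∀ v, U v → ℝ
  pU_mem : ∀ v u, 0 ≤ pU v u ∧ pU v u ≤ 1
  pU_sum : ∀ v, letI := fintU v; (∑ u, pU v u) = 1
  f : ∀ v, (∀ w, E w v → X w) → U v → X v

attribute [instance] FCM.fintX FCM.neX FCM.fintU

variable {V : Type} [Fintype V] [DecidableEq V] {E : V → V → Prop}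

/-- The average number of solutions `N̄ = Σ_u N(u) Π_v p^v(u_v)` of an fCM; the fCM is
consistent iff `N̄ ≠ 0`. -/
def FCM.Nbar (M : FCM V E) : ℝ :=
  ∑ u : ∀ v, M.U v,
    (∑ x : ∀ v, M.X v, ∏ v, kron (M.f v (fun w _ => x w) (u v)) (x v)) *
      ∏ v, M.pU v (u v)

/-- The distribution of a consistent fCM:
`P(x)_G = (Σ_u Π_v p^v(u_v) δ_{x_v, f^v(x_{pa(v)}, u_v)}) /`
`(Σ_y Σ_u Π_v p^v(u_v) δ_{y_v, f^v(y_{pa(v)}, u_v)})`. -/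
def FCM.Pdist (M : FCM V E) (x : ∀ v, M.X v) : ℝ :=
  (∑ u : ∀ v, M.U v, ∏ v, M.pU v (u v) * kron (x v) (M.f v (fun w _ => x w) (u v))) /
    (∑ y : ∀ v, M.X v, ∑ u : ∀ v, M.U v,
      ∏ v, M.pU v (u v) * kron (y v) (M.f v (fun w _ => y w) (u v)))

/-- The marginal, on the set of vertices `A`, of a joint distribution `P` on
`{X_v}_{v∈V}`, evaluated at (the `A`-components of) the joint assignment `x`. -/
def margf {V : Type} [Fintype V] [DecidableEq V] {X : V → Type} [∀ v, Fintype (X v)]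
    (P : (∀ v, X v) → ℝ) (A : Set V) (x : ∀ v, X v) : ℝ := by
  classical exact ∑ y : ∀ v, X v, if ∀ v ∈ A, y v = x v then P y else 0

/-- Conditional independence `(X₁ ⫫ X₂ | X₃)_P` of the (sets of) random variables
associated to disjoint vertex sets `V₁, V₂, V₃`, relative to the marginal of `P` on
`X₁ ∪ X₂ ∪ X₃`: for all values, `P(x₁, x₂ | x₃) = P(x₁ | x₃) P(x₂ | x₃)`. -/
def CondIndep {V : Type} [Fintype V] [DecidableEq V] {X : V → Type} [∀ v, Fintype (X v)]
    (P : (∀ v, X v) → ℝ) (V1 V2 V3 : Set V) : Prop :=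
  ∀ x : ∀ v, X v,
    margf P (V1 ∪ V2 ∪ V3) x / margf P V3 x =
      (margf P (V1 ∪ V3) x / margf P V3 x) * (margf P (V2 ∪ V3) x / margf P V3 x)

/-! ### Active walks in an acyclic directed graph -/

section ActiveWalks

variable {N : Type*} {F : N → N → Prop} {C src tgt : Set N}

/-- `w` belongs to `C` or has a descendant in `C`. -/
def IsAncestor (F : N → N → Prop) (C : Set N) (w : N) : Prop :=
  ∃ d ∈ C, Relation.ReflTransGen F w d

theorem IsAncestor.of_edge {a b : N} (h : F a b) (hb : IsAncestor F C b) :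
    IsAncestor F C a := by
  obtain ⟨d, hd, hbd⟩ := hb
  exact ⟨d, hd, hbd.head h⟩

theorem IsAncestor.of_mem {a : N} (h : a ∈ C) : IsAncestor F C a := ⟨a, h, .refl⟩

theorem Acyclic.asymm (hF : Acyclic F) {a b : N} (h : F a b) : ¬ F b a :=
  fun h' => hF a ((Relation.TransGen.single h).tail h')

/-- The walk `p 0, …, p n` is not blocked by `C`; repeated vertices are allowed. -/
structure IsActiveWalk (F : N → N → Prop) (C : Set N) (n : ℕ) (p : ℕ → N) : Prop where
  adj : ∀ k < n, F (p k) (p (k + 1)) ∨ F (p (k + 1)) (p k)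
  collider : ∀ k, k + 1 < n → F (p k) (p (k + 1)) → F (p (k + 2)) (p (k + 1)) →
    IsAncestor F C (p (k + 1))
  nonCollider : ∀ k, k + 1 < n → ¬ (F (p k) (p (k + 1)) ∧ F (p (k + 2)) (p (k + 1))) →
    p (k + 1) ∉ C

/-- Leaving a vertex that is not an ancestor of `C` along an outgoing edge, an active walk
keeps following edges forwards. -/
theorem IsActiveWalk.transGen_of_not_isAncestor {n : ℕ} {p : ℕ → N}
    (hp : IsActiveWalk F C n p) {i : ℕ} (hi : ¬ IsAncestor F C (p i))
    (h : F (p i) (p (i + 1))) (m : ℕ) (hm : i + m + 1 ≤ n) :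
    F (p (i + m)) (p (i + m + 1)) ∧ Relation.TransGen F (p i) (p (i + m + 1)) := by
  induction m with
  | zero => exact ⟨h, .single h⟩
  | succ m ih =>
    obtain ⟨hF, hT⟩ := ih (by omega)
    rcases hp.adj (i + m + 1) (by omega) with h' | h'
    · exact ⟨h', hT.tail h'⟩
    · obtain ⟨d, hd, hpd⟩ := hp.collider (i + m) (by omega) hF h'
      exact absurd ⟨d, hd, hT.to_reflTransGen.trans hpd⟩ hi

/-- Cutting out the closed part of an active walk between two visits to the same vertex leaves
an active walk. -/
theorem IsActiveWalk.shortcut (hF : Acyclic F) {n : ℕ} {p : ℕ → N}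
    (hp : IsActiveWalk F C n p) {i j : ℕ} (hij : i < j) (hj : j ≤ n) (hpij : p i = p j) :
    IsActiveWalk F C (n - (j - i)) (fun k => if k ≤ i then p k else p (k + (j - i))) := by
  have hlow : ∀ k ≤ i, (fun k => if k ≤ i then p k else p (k + (j - i))) k = p k := by
    intro k hk
    simp [hk]
  have hhigh : ∀ k, i ≤ k →
      (fun k => if k ≤ i then p k else p (k + (j - i))) k = p (k + (j - i)) := by
    intro k hk
    rcases hk.eq_or_lt with rfl | hk
    · simp only [le_refl, if_true]
      rw [hpij]
      congr 1
      omega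
    · simp [not_le.2 hk]
  generalize (fun k => if k ≤ i then p k else p (k + (j - i))) = q at hlow hhigh
  have hshift : ∀ k, i ≤ k → ∀ c, q (k + c) = p (k + (j - i) + c) := by
    intro k hk c
    rw [hhigh (k + c) (by omega)]
    congr 1
    omega
  refine ⟨fun k hk => ?_, fun k hk => ?_, fun k hk => ?_⟩
  · by_cases h : k + 1 ≤ i
    · rw [hlow k (by omega), hlow (k + 1) h]
      exact hp.adj k (by omega)
    · rw [hhigh k (by omega), hshift k (by omega) 1]
      exact hp.adj _ (by omega)
  · by_cases h : k + 2 ≤ i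
    · rw [hlow k (by omega), hlow (k + 1) (by omega), hlow (k + 2) h]
      exact hp.collider k (by omega)
    by_cases h' : i ≤ k
    · rw [hhigh k h', hshift k h' 1, hshift k h' 2]
      exact hp.collider _ (by omega)
    obtain rfl : i = k + 1 := by omega
    rw [hlow k (by omega), hlow (k + 1) le_rfl]
    intro hin _
    by_contra hanc
    rcases hp.adj (k + 1) (by omega) with hout | hcol
    · have := (hp.transGen_of_not_isAncestor hanc hout (j - (k + 1) - 1) (by omega)).2
      rw [show k + 1 + (j - (k + 1) - 1) + 1 = j by omega, ← hpij] at this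
      exact hF _ this
    · exact hanc (hp.collider k (by omega) hin hcol)
  · by_cases h : k + 2 ≤ i
    · rw [hlow k (by omega), hlow (k + 1) (by omega), hlow (k + 2) h]
      exact hp.nonCollider k (by omega)
    by_cases h' : i ≤ k
    · rw [hhigh k h', hshift k h' 1, hshift k h' 2]
      exact hp.nonCollider _ (by omega)
    obtain rfl : i = k + 1 := by omega
    rw [hlow k (by omega), hlow (k + 1) le_rfl, hhigh (k + 2) (by omega)]
    intro hnot
    by_cases hin : F (p k) (p (k + 1))
    · have := hp.nonCollider (j - 1) (by omega)
      rw [show j - 1 + 1 = j by omega, show j - 1 + 2 = k + 2 + (j - (k + 1)) by omega,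
        ← hpij] at this
      exact this fun h => hnot ⟨hin, h.2⟩
    · exact hp.nonCollider k (by omega) fun h => hin h.1

/-- An active walk can be shortened to an active walk without repeated vertices. -/
theorem IsActiveWalk.exists_injOn (hF : Acyclic F) {n : ℕ} {p : ℕ → N}
    (hp : IsActiveWalk F C n p) :
    ∃ m q, IsActiveWalk F C m q ∧ q 0 = p 0 ∧ q m = p n ∧
      ∀ i j, i < j → j ≤ m → q i ≠ q j := by
  induction n using Nat.strong_induction_on generalizing p with
  | _ n ih =>
    by_cases h : ∀ i j, i < j → j ≤ n → p i ≠ p j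
    · exact ⟨n, p, hp, rfl, rfl, h⟩
    push Not at h
    obtain ⟨i, j, hij, hj, hpij⟩ := h
    obtain ⟨m, q, hq, hq0, hqm, hinj⟩ := ih _ (by omega) (hp.shortcut hF hij hj hpij)
    refine ⟨m, q, hq, by simpa using hq0, hqm.trans ?_, hinj⟩
    split_ifs with h
    · rw [show n - (j - i) = i by omega, hpij]
      congr 1
      omega
    · congr 1
      omega

/-- `d`-separated sets are not joined by an active walk. -/
theorem DSep.not_isActiveWalk (hF : Acyclic F) (hsep : DSep F tgt src C) {n : ℕ} {p : ℕ → N}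
    (hp : IsActiveWalk F C n p) (h0 : p 0 ∈ tgt) (hn : p n ∈ src) : False := by
  obtain ⟨m, q, hq, hq0, hqm, hinj⟩ := hp.exists_injOn hF
  have hpath : IsUPath F ((List.range (m + 1)).map q) := by
    refine ⟨?_, ?_⟩
    · refine List.isChain_iff_getElem.2 ?_
      intro i hi
      simp only [List.length_map, List.length_range] at hi
      simpa using hq.adj i (by omega)
    · refine List.Nodup.map_on ?_ List.nodup_range
      intro i hi j hj hqij
      simp only [List.mem_range] at hi hj
      rcases lt_trichotomy i j with h | h | h
      · exact absurd hqij (hinj i j h (by omega))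
      · exact h
      · exact absurd hqij.symm (hinj j i h (by omega))
  obtain ⟨l, A, W, B, r, hdec, hblock⟩ := hsep _ (q 0) (q m) (hq0 ▸ h0) (hqm ▸ hn) hpath
    (by simp [List.range_succ_eq_map]) (by simp [List.range_succ])
  have hlen := congrArg List.length hdec
  simp only [List.length_map, List.length_range, List.length_append, List.length_cons] at hlen
  have hget : ∀ k (hk : k < m + 1),
      (l ++ A :: W :: B :: r)[k]? = some (q k) := by
    intro k hk
    rw [← hdec]
    simp [hk]
  have hA := hget l.length (by omega)
  have hW := hget (l.length + 1) (by omega)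
  have hB := hget (l.length + 2) (by omega)
  simp at hA hW hB
  subst hA hW hB
  have hcol := hq.collider l.length (by omega)
  have hnon := hq.nonCollider l.length (by omega)
  rcases hblock with ⟨h, h', hC⟩ | ⟨h, h', hC⟩ | ⟨h, h', hC⟩ | ⟨h, h', hC, hdesc⟩
  · exact hnon (fun hc => hF.asymm h' hc.2) hC
  · exact hnon (fun hc => hF.asymm h' hc.1) hC
  · exact hnon (fun hc => hF.asymm h' hc.2) hC
  · obtain ⟨d, hd, hWd⟩ := hcol h h'
    rcases Relation.reflTransGen_iff_eq_or_transGen.1 hWd with rfl | hWd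
    · exact hC hd
    · exact hdesc d hWd hd

/-- `w` starts an active walk to `src` that is trivial or leaves `w` along an outgoing edge. -/
def ActiveOut (F : N → N → Prop) (C src : Set N) (w : N) : Prop :=
  ∃ n p, IsActiveWalk F C n p ∧ p 0 = w ∧ p n ∈ src ∧ (0 < n → F w (p 1))

/-- `w` starts an active walk to `src` that leaves `w` against an incoming edge. -/
def ActiveIn (F : N → N → Prop) (C src : Set N) (w : N) : Prop :=
  ∃ n p, IsActiveWalk F C n p ∧ p 0 = w ∧ p n ∈ src ∧ 0 < n ∧ F (p 1) w

/-- `w` starts an active walk to `src` that stays active when preceded by any edge into `w`. -/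
def ActiveFrom (F : N → N → Prop) (C src : Set N) (w : N) : Prop :=
  (ActiveIn F C src w ∧ IsAncestor F C w) ∨ (ActiveOut F C src w ∧ w ∉ C)

theorem IsActiveWalk.cons {n : ℕ} {p : ℕ → N} (hp : IsActiveWalk F C n p) {x : N}
    (hadj : F x (p 0) ∨ F (p 0) x)
    (hcol : 0 < n → F x (p 0) → F (p 1) (p 0) → IsAncestor F C (p 0))
    (hnon : 0 < n → ¬ (F x (p 0) ∧ F (p 1) (p 0)) → p 0 ∉ C) :
    IsActiveWalk F C (n + 1) (fun k => Nat.casesOn k x p) := by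
  refine ⟨fun k hk => ?_, fun k hk => ?_, fun k hk => ?_⟩
  · cases k with
    | zero => exact hadj
    | succ k => exact hp.adj k (by omega)
  · cases k with
    | zero => exact hcol (by omega)
    | succ k => exact hp.collider k (by omega)
  · cases k with
    | zero => exact hnon (by omega)
    | succ k => exact hp.nonCollider k (by omega)

theorem ActiveOut.of_mem {w : N} (h : w ∈ src) : ActiveOut F C src w :=
  ⟨0, fun _ => w, ⟨by simp, by simp, by simp⟩, rfl, h, by simp⟩

theorem ActiveOut.parent (hF : Acyclic F) {w x : N} (hw : ActiveOut F C src w) (hC : w ∉ C)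
    (h : F x w) : ActiveOut F C src x := by
  obtain ⟨n, p, hp, rfl, hn, hout⟩ := hw
  exact ⟨n + 1, _, hp.cons (.inl h) (fun hn _ h' => absurd h' (hF.asymm (hout hn)))
    (fun _ _ => hC), rfl, hn, fun _ => h⟩

theorem ActiveOut.child (hF : Acyclic F) {w x : N} (hw : ActiveOut F C src w) (hC : w ∉ C)
    (h : F w x) : ActiveIn F C src x := by
  obtain ⟨n, p, hp, rfl, hn, hout⟩ := hw
  exact ⟨n + 1, _, hp.cons (.inr h) (fun _ h' => absurd h' (hF.asymm h))
    (fun _ _ => hC), rfl, hn, n.succ_pos, h⟩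

theorem ActiveIn.parent {w x : N} (hw : ActiveIn F C src w)
    (hanc : IsAncestor F C w) (h : F x w) : ActiveOut F C src x := by
  obtain ⟨n, p, hp, rfl, hn, -, hin⟩ := hw
  exact ⟨n + 1, _, hp.cons (.inl h) (fun _ _ _ => hanc)
    (fun _ h' => absurd ⟨h, hin⟩ h'), rfl, hn, fun _ => h⟩

theorem ActiveIn.child (hF : Acyclic F) {w x : N} (hw : ActiveIn F C src w) (hC : w ∉ C)
    (h : F w x) : ActiveIn F C src x := by
  obtain ⟨n, p, hp, rfl, hn, -, hin⟩ := hw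
  exact ⟨n + 1, _, hp.cons (.inr h) (fun _ h' => absurd h' (hF.asymm h))
    (fun _ _ => hC), rfl, hn, n.succ_pos, h⟩

theorem ActiveIn.descendant (hF : Acyclic F) {w d : N} (hw : ActiveIn F C src w)
    (hanc : ¬ IsAncestor F C w) (h : Relation.ReflTransGen F w d) : ActiveIn F C src d := by
  induction h with
  | refl => exact hw
  | tail hwb hbc ih => exact ih.child hF (fun hb => hanc ⟨_, hb, hwb⟩) hbc

theorem ActiveOut.of_descendant (hF : Acyclic F) {w d : N} (hd : d ∈ src)
    (hanc : ¬ IsAncestor F C w) (h : Relation.ReflTransGen F w d) : ActiveOut F C src w := by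
  induction h using Relation.ReflTransGen.head_induction_on with
  | refl => exact .of_mem hd
  | head hab _ ih =>
    have hb := fun hb => hanc (IsAncestor.of_edge hab hb)
    exact (ih hb).parent hF (fun hC => hb (.of_mem hC)) hab

/-- For `d`-separated sets, inside the ancestral closure of `src ∪ tgt ∪ C` every active walk
from `src` can be continued through a collider. -/
theorem ActiveIn.activeFrom (hF : Acyclic F) (hsep : DSep F tgt src C) {w : N}
    (hw : ActiveIn F C src w) (hD : IsAncestor F (src ∪ tgt ∪ C) w) : ActiveFrom F C src w := by
  by_cases hanc : IsAncestor F C w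
  · exact .inl ⟨hw, hanc⟩
  obtain ⟨d, (hd | hd) | hd, hwd⟩ := hD
  · exact .inr ⟨.of_descendant hF hd hanc hwd, fun hC => hanc (.of_mem hC)⟩
  · obtain ⟨n, p, hp, rfl, hn, -⟩ := hw.descendant hF hanc hwd
    exact (hsep.not_isActiveWalk hF hp hd hn).elim
  · exact absurd ⟨d, hd, hwd⟩ hanc

theorem ActiveFrom.parent (hF : Acyclic F) {w x : N} (hw : ActiveFrom F C src w) (h : F x w)
    (hx : x ∉ C) : ActiveFrom F C src x := by
  rcases hw with ⟨hw, hanc⟩ | ⟨hw, hC⟩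
  · exact .inr ⟨hw.parent hanc h, hx⟩
  · exact .inr ⟨hw.parent hF hC h, hx⟩

theorem ActiveFrom.child (hF : Acyclic F) (hsep : DSep F tgt src C) {w x : N}
    (hw : ActiveFrom F C src w) (hC : w ∉ C) (h : F w x)
    (hx : IsAncestor F (src ∪ tgt ∪ C) x) : ActiveFrom F C src x := by
  rcases hw with ⟨hw, -⟩ | ⟨hw, -⟩
  · exact (hw.child hF hC h).activeFrom hF hsep hx
  · exact (hw.child hF hC h).activeFrom hF hsep hx

theorem ActiveFrom.notMem (hF : Acyclic F) (hsep : DSep F tgt src C) {w : N}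
    (hw : ActiveFrom F C src w) : w ∉ tgt := by
  intro h
  rcases hw with ⟨⟨n, p, hp, rfl, hn, -⟩, -⟩ | ⟨⟨n, p, hp, rfl, hn, -⟩, -⟩ <;>
    exact hsep.not_isActiveWalk hF hp h hn

end ActiveWalks

/-! ### The teleportation graph -/

section Teleportation

variable {V : Type*} {E : V → V → Prop} {S : Set V}

theorem transGen_teleE_inl {a : V} {z : V ⊕ (↥S ⊕ ↥S)}
    (h : Relation.TransGen (teleE E S) (Sum.inl a) z) :
    (∃ b, z = Sum.inl b ∧ Relation.TransGen (fun a b => E a b ∧ a ∉ S) a b) ∨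
      ∃ t, z = Sum.inr (Sum.inr t) := by
  induction h with
  | @single z h =>
    rcases z with b | r | t
    · exact .inl ⟨b, rfl, .single h⟩
    · exact h.elim
    · exact .inr ⟨t, rfl⟩
  | @tail y z _ h ih =>
    rcases ih with ⟨b, rfl, hb⟩ | ⟨t, rfl⟩
    · rcases z with c | r | t
      · exact .inl ⟨c, rfl, hb.tail h⟩
      · exact h.elim
      · exact .inr ⟨t, rfl⟩
    · exact h.elim

theorem Acyclic.teleE (hS : Acyclic fun a b => E a b ∧ a ∉ S) : Acyclic (teleE E S) := by
  rintro (a | r | t) h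
  · rcases transGen_teleE_inl h with ⟨b, hb, hab⟩ | ⟨t, ht⟩
    · cases hb
      exact hS a hab
    · cases ht
  · obtain ⟨b, -, h⟩ := Relation.TransGen.tail'_iff.1 h
    rcases b with b | b | b <;> exact h.elim
  · obtain ⟨b, h, -⟩ := Relation.TransGen.head'_iff.1 h
    exact h.elim

open Classical in
/-- The vertex of the teleportation graph at which the edges of `a` start. -/
def outVertex (S : Set V) (a : V) : V ⊕ (↥S ⊕ ↥S) :=
  if h : a ∈ S then Sum.inr (Sum.inl ⟨a, h⟩) else Sum.inl a

theorem teleE_outVertex {a b : V} (h : E a b) : teleE E S (outVertex S a) (Sum.inl b) := by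
  unfold outVertex
  split_ifs with ha
  · exact h
  · exact ⟨h, ha⟩

variable {V1 V2 V3 : Set V}

theorem outVertex_notMem {a : V} (ha : a ∉ V3) :
    outVertex S a ∉ Sum.inl '' V3 ∪ postVerts S := by
  unfold outVertex postVerts
  split_ifs with h <;> simp [ha]

theorem inl_notMem {a : V} (ha : a ∉ V3) :
    (Sum.inl a : V ⊕ (↥S ⊕ ↥S)) ∉ Sum.inl '' V3 ∪ postVerts S := by
  simp [postVerts, ha]

theorem isAncestor_postVert (t : S) {B : Set (V ⊕ (↥S ⊕ ↥S))} :
    IsAncestor (teleE E S) (B ∪ (Sum.inl '' V3 ∪ postVerts S)) (Sum.inr (Sum.inr t)) :=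
  .of_mem (.inr (.inr ⟨t, rfl⟩))

theorem activeFrom_inl_iff_outVertex (hS : Acyclic fun a b => E a b ∧ a ∉ S)
    (hsep : DSep (teleE E S) (Sum.inl '' V1) (Sum.inl '' V2) (Sum.inl '' V3 ∪ postVerts S))
    {a : V} (ha : a ∉ V3) :
    ActiveFrom (teleE E S) (Sum.inl '' V3 ∪ postVerts S) (Sum.inl '' V2) (Sum.inl a) ↔
      ActiveFrom (teleE E S) (Sum.inl '' V3 ∪ postVerts S) (Sum.inl '' V2)
        (outVertex S a) := by
  by_cases h : a ∈ S
  · have hin : teleE E S (Sum.inl a) (Sum.inr (Sum.inr ⟨a, h⟩)) := rfl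
    have hout : teleE E S (outVertex S a) (Sum.inr (Sum.inr ⟨a, h⟩)) := by
      simp [outVertex, h, teleE]
    exact ⟨fun hA => (hA.child hS.teleE hsep (inl_notMem ha) hin
        (isAncestor_postVert _)).parent hS.teleE hout (outVertex_notMem ha),
      fun hA => (hA.child hS.teleE hsep (outVertex_notMem ha) hout
        (isAncestor_postVert _)).parent hS.teleE hin (inl_notMem ha)⟩
  · simp [outVertex, h]

/-- The graphical content of `p`-separation: an ancestrally closed set `D` of vertices, and a
set `A` separating `V₂` from `V₁` such that no parent family in `D` meets both `A` and the
complement of `A ∪ V₃`. -/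
theorem PSep.exists_separation (h23 : Disjoint V2 V3)
    (h : PSep E V1 V2 V3) :
    ∃ S D A : Set V, (Acyclic fun a b => E a b ∧ a ∉ S) ∧ S ⊆ D ∧ V1 ⊆ D ∧ V2 ⊆ D ∧ V3 ⊆ D ∧
      (∀ v ∈ D, ∀ w, E w v → w ∈ D) ∧ V2 ⊆ A ∧ Disjoint V1 A ∧ Disjoint V3 A ∧
      ∀ v ∈ D, ∀ a b, (a = v ∨ E a v) → (b = v ∨ E b v) → a ∈ A → b ∉ V3 → b ∈ A := by
  obtain ⟨S, hS, hsep⟩ := h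
  set C : Set (V ⊕ (↥S ⊕ ↥S)) := Sum.inl '' V3 ∪ postVerts S
  set D : Set V := {v | IsAncestor (teleE E S) (Sum.inl '' V2 ∪ Sum.inl '' V1 ∪ C) (Sum.inl v)}
  have hSD : S ⊆ D := fun v hv =>
    IsAncestor.of_edge (b := Sum.inr (Sum.inr ⟨v, hv⟩)) rfl (isAncestor_postVert _)
  refine ⟨S, D, {v | v ∉ V3 ∧ ActiveFrom (teleE E S) C (Sum.inl '' V2) (Sum.inl v)}, hS, hSD,
    fun v hv => .of_mem (.inl (.inr ⟨v, hv, rfl⟩)),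
    fun v hv => .of_mem (.inl (.inl ⟨v, hv, rfl⟩)),
    fun v hv => .of_mem (.inr (.inl ⟨v, hv, rfl⟩)), ?_, ?_, ?_, ?_, ?_⟩
  · intro v hv w hwv
    by_cases hw : w ∈ S
    · exact hSD hw
    · exact IsAncestor.of_edge (b := Sum.inl v) ⟨hwv, hw⟩ hv
  · intro v hv
    have hv3 := Set.disjoint_left.1 h23 hv
    exact ⟨hv3, .inr ⟨.of_mem ⟨v, hv, rfl⟩, inl_notMem hv3⟩⟩
  · rw [Set.disjoint_left]
    exact fun v hv hA => hA.2.notMem hS.teleE hsep ⟨v, hv, rfl⟩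
  · rw [Set.disjoint_left]
    exact fun v hv hA => hA.1 hv
  · rintro v hv a b ha hb ⟨ha3, haA⟩ hb3
    refine ⟨hb3, ?_⟩
    have hvA : ActiveFrom (teleE E S) C (Sum.inl '' V2) (Sum.inl v) := by
      rcases ha with rfl | ha
      · exact haA
      · exact ((activeFrom_inl_iff_outVertex hS hsep ha3).1 haA).child hS.teleE hsep
          (outVertex_notMem ha3) (teleE_outVertex ha) hv
    rcases hb with rfl | hb
    · exact hvA
    · exact (activeFrom_inl_iff_outVertex hS hsep hb3).2
        (hvA.parent hS.teleE (teleE_outVertex hb) (outVertex_notMem hb3))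

end Teleportation

/-! ### Summing over joint assignments -/

section Sums

variable {V : Type} [Fintype V] [DecidableEq V] {X : V → Type} [∀ v, Fintype (X v)]

theorem sum_sum_update (w : V) (φ : (∀ v, X v) → ℝ) :
    ∑ y, ∑ a, φ (Function.update y w a) = Fintype.card (X w) * ∑ y, φ y := by
  let e : (∀ v, X v) × X w → (∀ v, X v) × X w := fun q => (Function.update q.1 w q.2, q.1 w)
  have he : Function.Involutive e := fun q => by simp [e]
  rw [← Fintype.sum_prod_type' (f := fun y a => φ (Function.update y w a)),
    ← Equiv.sum_comp (he.toPerm e)]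
  simp [e, Function.Involutive.toPerm, Fintype.sum_prod_type, Finset.mul_sum]

/-- Exchanging the `A`-components of two assignments turns a factorization into a product
identity of sums. -/
theorem sum_mul_sum_eq_of_factorization (φ ψ : (∀ v, X v) → ℝ) (x : ∀ v, X v)
    (V1 V2 V3 A : Set V) (h2A : V2 ⊆ A) (h1A : Disjoint V1 A) (h3A : Disjoint V3 A)
    (hφ : ∀ y z : ∀ v, X v, (∀ v ∈ A ∪ V3, y v = z v) → φ y = φ z)
    (hψ : ∀ y z : ∀ v, X v, (∀ v ∉ A, y v = z v) → ψ y = ψ z) :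
    margf (fun y => φ y * ψ y) (V1 ∪ V2 ∪ V3) x * margf (fun y => φ y * ψ y) V3 x =
      margf (fun y => φ y * ψ y) (V1 ∪ V3) x * margf (fun y => φ y * ψ y) (V2 ∪ V3) x := by
  classical
  let mix : (∀ v, X v) → (∀ v, X v) → ∀ v, X v := fun y z v => if v ∈ A then z v else y v
  let e : (∀ v, X v) × (∀ v, X v) → (∀ v, X v) × (∀ v, X v) :=
    fun q => (mix q.1 q.2, mix q.2 q.1)
  have he : Function.Involutive e := by
    rintro ⟨y, z⟩
    ext v <;> by_cases hv : v ∈ A <;> simp [e, mix, hv]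
  have hin : ∀ y z v, v ∈ A → mix y z v = z v := fun y z v hv => if_pos hv
  have hout : ∀ y z v, v ∉ A → mix y z v = y v := fun y z v hv => if_neg hv
  have h1 : ∀ v ∈ V1, v ∉ A := fun v hv => Set.disjoint_left.1 h1A hv
  have h3 : ∀ v ∈ V3, v ∉ A := fun v hv => Set.disjoint_left.1 h3A hv
  unfold margf
  simp only [Finset.sum_mul_sum, ← Fintype.sum_prod_type']
  rw [← Equiv.sum_comp (he.toPerm e)]
  refine Finset.sum_congr rfl ?_
  rintro ⟨y, z⟩ -
  change (if ∀ v ∈ V1 ∪ V2 ∪ V3, mix y z v = x v then φ (mix y z) * ψ (mix y z) else 0) *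
      (if ∀ v ∈ V3, mix z y v = x v then φ (mix z y) * ψ (mix z y) else 0) =
    (if ∀ v ∈ V1 ∪ V3, y v = x v then φ y * ψ y else 0) *
      (if ∀ v ∈ V2 ∪ V3, z v = x v then φ z * ψ z else 0)
  have hcond : ((∀ v ∈ V1 ∪ V2 ∪ V3, mix y z v = x v) ∧ ∀ v ∈ V3, mix z y v = x v) ↔
      ((∀ v ∈ V1 ∪ V3, y v = x v) ∧ ∀ v ∈ V2 ∪ V3, z v = x v) := by
    constructor
    · rintro ⟨hy, hz⟩
      refine ⟨?_, ?_⟩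
      · rintro v (hv | hv)
        · rw [← hy v (.inl (.inl hv)), hout _ _ _ (h1 v hv)]
        · rw [← hy v (.inr hv), hout _ _ _ (h3 v hv)]
      · rintro v (hv | hv)
        · rw [← hy v (.inl (.inr hv)), hin _ _ _ (h2A hv)]
        · rw [← hz v hv, hout _ _ _ (h3 v hv)]
    · rintro ⟨hy, hz⟩
      refine ⟨?_, ?_⟩
      · rintro v ((hv | hv) | hv)
        · rw [hout _ _ _ (h1 v hv), hy v (.inl hv)]
        · rw [hin _ _ _ (h2A hv), hz v (.inl hv)]
        · rw [hout _ _ _ (h3 v hv), hy v (.inr hv)]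
      · intro v hv
        rw [hout _ _ _ (h3 v hv), hz v (.inr hv)]
  rw [ite_zero_mul_ite_zero, ite_zero_mul_ite_zero]
  refine ite_congr (propext hcond) (fun hc => ?_) fun _ => rfl
  obtain ⟨hy, hz⟩ := hc
  have hy3 : ∀ v ∈ V3, y v = z v := fun v hv => (hy v (.inr hv)).trans (hz v (.inr hv)).symm
  have hφyz : φ (mix y z) = φ z := hφ _ _ <| by
    rintro v (hv | hv)
    · exact hin _ _ _ hv
    · rw [hout _ _ _ (h3 v hv), hy3 v hv]
  have hφzy : φ (mix z y) = φ y := hφ _ _ <| by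
    rintro v (hv | hv)
    · exact hin _ _ _ hv
    · rw [hout _ _ _ (h3 v hv), hy3 v hv]
  rw [hφyz, hφzy, hψ (mix y z) y (hout y z), hψ (mix z y) z (hout z y)]
  ring

end Sums

namespace FCM

/-- The probability that vertex `v` takes the value `y v` when its parents take theirs. -/
def kernel (M : FCM V E) (v : V) (y : ∀ v, M.X v) : ℝ :=
  ∑ u, M.pU v u * kron (y v) (M.f v (fun w _ => y w) u)

theorem kernel_congr (M : FCM V E) (v : V) {y z : ∀ v, M.X v} (hv : y v = z v)
    (hpa : ∀ w, E w v → y w = z w) : M.kernel v y = M.kernel v z := by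
  have : (fun w (_ : E w v) => y w) = fun w _ => z w := by
    funext w hw
    exact hpa w hw
  simp only [kernel, hv, this]

theorem sum_kernel_update (M : FCM V E) (v : V) (hv : ¬ E v v) (y : ∀ v, M.X v) :
    ∑ a, M.kernel v (Function.update y v a) = 1 := by
  have hpa : ∀ a, (fun w (_ : E w v) => Function.update y v a w) = fun w _ => y w := by
    intro a
    funext w hw
    exact Function.update_of_ne (fun h : w = v => hv (h ▸ hw)) _ _
  simp only [kernel, hpa, Function.update_self]
  rw [Finset.sum_comm, ← M.pU_sum v]
  exact Finset.sum_congr rfl fun u _ => by classical simp [kron]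

theorem Pdist_eq_prod_kernel (M : FCM V E) :
    ∃ c, ∀ y, M.Pdist y = c * ∏ v, M.kernel v y := by
  refine ⟨(∑ y : ∀ v, M.X v, ∑ u : ∀ v, M.U v,
      ∏ v, M.pU v (u v) * kron (y v) (M.f v (fun w _ => y w) (u v)))⁻¹, fun y => ?_⟩
  have : ∏ v, M.kernel v y =
      ∑ u : ∀ v, M.U v, ∏ v, M.pU v (u v) * kron (y v) (M.f v (fun w _ => y w) (u v)) := by
    simp only [kernel]
    rw [Finset.prod_univ_sum, Fintype.piFinset_univ]
  rw [this, Pdist, div_eq_inv_mul]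

/-- The kernels of an acyclic set `W` of vertices sum out against a function that does not
depend on the values at `W`. -/
theorem sum_mul_prod_kernel (M : FCM V E) {S : Set V}
    (hS : Acyclic fun a b => E a b ∧ a ∉ S) (W : Finset V) (hW : ∀ w ∈ W, w ∉ S)
    (h : (∀ v, M.X v) → ℝ) (hh : ∀ y, ∀ w ∈ W, ∀ a, h (Function.update y w a) = h y) :
    (∏ w ∈ W, (Fintype.card (M.X w) : ℝ)) * ∑ y, h y * ∏ w ∈ W, M.kernel w y = ∑ y, h y := by
  induction W using Finset.strongInduction with
  | H W ih =>
    rcases W.eq_empty_or_nonempty with rfl | hne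
    · simp
    let r : V → V → Prop := fun a b => Relation.TransGen (fun a b => E a b ∧ a ∉ S) b a
    have : Std.Irrefl r := ⟨hS⟩
    have : IsTrans V r := ⟨fun _ _ _ hab hbc => hbc.trans hab⟩
    obtain ⟨w, hw, hmin⟩ := (Finite.wellFounded_of_trans_of_irrefl r).has_min (W : Set V) hne
    have hsink : ∀ v ∈ W, ¬ E w v := fun v hv hwv => hmin v hv (.single ⟨hwv, hW w hw⟩)
    rw [← ih (W.erase w) (Finset.erase_ssubset hw)
      (fun v hv => hW v (Finset.mem_of_mem_erase hv))
      (fun y v hv => hh y v (Finset.mem_of_mem_erase hv)),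
      ← Finset.mul_prod_erase W _ hw, mul_comm (Fintype.card (M.X w) : ℝ), mul_assoc,
      ← sum_sum_update]
    congr 1
    refine Finset.sum_congr rfl fun y _ => ?_
    have hrest : ∀ a, ∏ v ∈ W.erase w, M.kernel v (Function.update y w a) =
        ∏ v ∈ W.erase w, M.kernel v y := fun a => Finset.prod_congr rfl fun v hv =>
      M.kernel_congr v (Function.update_of_ne (Finset.ne_of_mem_erase hv) _ _) fun u hu =>
        Function.update_of_ne
          (fun h : u = w => hsink v (Finset.mem_of_mem_erase hv) (h ▸ hu)) _ _
    simp only [← Finset.mul_prod_erase W _ hw, hrest, hh y w hw]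
    calc _ = (∑ a, M.kernel w (Function.update y w a)) *
          (h y * ∏ v ∈ W.erase w, M.kernel v y) := by
            rw [Finset.sum_mul]
            exact Finset.sum_congr rfl fun a _ => by ring
      _ = _ := by rw [M.sum_kernel_update w (hsink w hw), one_mul]

open Classical in
/-- Marginals on subsets of an ancestrally closed set `D` only involve the kernels of `D`. -/
theorem exists_margf_Pdist_eq (M : FCM V E) {S D : Set V}
    (hS : Acyclic fun a b => E a b ∧ a ∉ S) (hSD : S ⊆ D)
    (hD : ∀ v ∈ D, ∀ w, E w v → w ∈ D) :
    ∃ c, ∀ B ⊆ D, ∀ x, margf M.Pdist B x =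
      c * margf (fun y => ∏ v with v ∈ D, M.kernel v y) B x := by
  obtain ⟨c, hc⟩ := M.Pdist_eq_prod_kernel
  set W : Finset V := Finset.univ.filter (· ∉ D) with hWdef
  have hW : ∀ w ∈ W, w ∉ D := fun w hw => (Finset.mem_filter.1 hw).2
  have hcard : (∏ w ∈ W, (Fintype.card (M.X w) : ℝ)) ≠ 0 :=
    Finset.prod_ne_zero_iff.2 fun w _ => Nat.cast_ne_zero.2 Fintype.card_ne_zero
  refine ⟨c * (∏ w ∈ W, (Fintype.card (M.X w) : ℝ))⁻¹, fun B hB x => ?_⟩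
  have key := M.sum_mul_prod_kernel hS W (fun w hw h => hW w hw (hSD h))
    (fun y => if ∀ v ∈ B, y v = x v then ∏ v with v ∈ D, M.kernel v y else 0) (by
      intro y w hw a
      have hne : ∀ v ∈ D, v ≠ w := fun v hv h => hW w hw (h ▸ hv)
      have hprod : ∏ v with v ∈ D, M.kernel v (Function.update y w a) =
          ∏ v with v ∈ D, M.kernel v y := Finset.prod_congr rfl fun v hv => by
        have hv := (Finset.mem_filter.1 hv).2
        exact M.kernel_congr v (Function.update_of_ne (hne v hv) _ _) fun u hu =>
          Function.update_of_ne (hne u (hD v hv u hu)) _ _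
      refine ite_congr (propext (forall₂_congr fun v hv => ?_)) (fun _ => hprod) fun _ => rfl
      rw [Function.update_of_ne (hne v (hB hv))])
  unfold margf
  rw [← key, mul_assoc, inv_mul_cancel_left₀ hcard, Finset.mul_sum]
  refine Finset.sum_congr rfl fun y _ => ?_
  rw [hc y, ← Finset.prod_filter_mul_prod_filter_not Finset.univ (· ∈ D)]
  split_ifs <;> simp [hWdef]

end FCM

/-- **soundness of `p`-separation.**
Let `G = (V, E)` be a directed graph with finite vertex set and let `V₁, V₂, V₃` be disjoint
subsets of `V` with `V₁, V₂` nonempty.  If `(V₁ ⊥^p V₂ | V₃)_G` holds, then for every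
consistent finite functional causal model `M` on `G`, the associated random variables
satisfy the conditional independence `(X₁ ⫫ X₂ | X₃)` with respect to the distribution
`P(x)_G` of `M`. -/
theorem psep_soundness
    (E : V → V → Prop) (V1 V2 V3 : Set V)
    (h12 : Disjoint V1 V2) (h13 : Disjoint V1 V3) (h23 : Disjoint V2 V3)
    (h1 : V1.Nonempty) (h2 : V2.Nonempty)
    (hpsep : PSep E V1 V2 V3)
    (M : FCM V E) (hcons : M.Nbar ≠ 0) :
    CondIndep M.Pdist V1 V2 V3 := by
    classical
  obtain ⟨S, D, A, hS, hSD, h1D, h2D, h3D, hD, h2A, h1A, h3A, hfam⟩ :=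
    hpsep.exists_separation h23
  obtain ⟨c, hc⟩ := M.exists_margf_Pdist_eq hS hSD hD
  let inA : V → Prop := fun v => ∃ a, (a = v ∨ E a v) ∧ a ∈ A
  have hfact : (fun y => ∏ v with v ∈ D, M.kernel v y) = fun y =>
      (∏ v with v ∈ D ∧ inA v, M.kernel v y) * ∏ v with v ∈ D ∧ ¬ inA v, M.kernel v y := by
    funext y
    rw [← Finset.prod_filter_mul_prod_filter_not _ inA, Finset.filter_filter,
      Finset.filter_filter]
  have key (x : ∀ v, M.X v) := sum_mul_sum_eq_of_factorization
    (fun y => ∏ v with v ∈ D ∧ inA v, M.kernel v y)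
    (fun y => ∏ v with v ∈ D ∧ ¬ inA v, M.kernel v y) x V1 V2 V3 A h2A h1A h3A
    (fun y z hyz => Finset.prod_congr rfl fun v hv => by
      obtain ⟨hv, a, ha, haA⟩ := (Finset.mem_filter.1 hv).2
      have hmem : ∀ b, (b = v ∨ E b v) → b ∈ A ∪ V3 := fun b hb =>
        or_iff_not_imp_right.2 (hfam v hv a b ha hb haA)
      exact M.kernel_congr v (hyz v (hmem v (.inl rfl))) fun w hw => hyz w (hmem w (.inr hw)))
    (fun y z hyz => Finset.prod_congr rfl fun v hv => by
      have hv := (Finset.mem_filter.1 hv).2.2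
      exact M.kernel_congr v (hyz v fun h => hv ⟨v, .inl rfl, h⟩)
        fun w hw => hyz w fun h => hv ⟨w, .inr hw, h⟩)
  intro x
  have hprod : margf M.Pdist (V1 ∪ V2 ∪ V3) x * margf M.Pdist V3 x =
      margf M.Pdist (V1 ∪ V3) x * margf M.Pdist (V2 ∪ V3) x := by
    rw [hc _ (Set.union_subset (Set.union_subset h1D h2D) h3D), hc _ h3D,
      hc _ (Set.union_subset h1D h3D), hc _ (Set.union_subset h2D h3D), hfact]
    linear_combination c ^ 2 * key x
  rcases eq_or_ne (margf M.Pdist V3 x) 0 with h0 | h0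
  · simp [h0]
  · field_simp
    exact hprod
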